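/- arXiv:1803.08096 — 2 statements merged into one kernel-verified Lean document; each statement's English description precedes it below -/
import Mathlib

section
/- There exist constants C > 0 and ε > 0 depending only on s ∈ (1,2) such that for u ∈ H¹(B_1) ∩ L³(B_1) in ℝ^5 and 0 < θ ≤ 1/2, if the one-step inequality C θ^{3(6s−8)} C(1) ≤ 1/6 holds (e.g. C(1) small), then C(θ) ≤ C θ^{6s−3} C(1) + C θ^{3(6s−8)} C(1) B(1) + C B(1), where C(r) = r^{−8+6s} ∫_{B_r}|u|³ dx and B(r) = r^{−5+4s} ∫_{B_r}|∇u|² dx. -/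
open MeasureTheory Metric Filter Set

noncomputable section

/-- The scale-invariant cubic quantity `C(r) = r^{-8+6s} ∫_{B_r} |u|³ dx`. -/
def Cq (s : ℝ) (u : EuclideanSpace ℝ (Fin 5) → EuclideanSpace ℝ (Fin 5)) (r : ℝ) : ℝ :=
  r ^ (-8 + 6 * s) * ∫ x in ball (0 : EuclideanSpace ℝ (Fin 5)) r, ‖u x‖ ^ 3

/-- The scale-invariant gradient energy `B(r) = r^{-5+4s} ∫_{B_r} |∇u|² dx`. -/
def Bq (s : ℝ) (u : EuclideanSpace ℝ (Fin 5) → EuclideanSpace ℝ (Fin 5)) (r : ℝ) : ℝ :=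
  r ^ (-5 + 4 * s) * ∫ x in ball (0 : EuclideanSpace ℝ (Fin 5)) r, ‖fderiv ℝ u x‖ ^ 2

section Poincare

open Module

variable {E F : Type*} [NormedAddCommGroup E] [NormedSpace ℝ E] [FiniteDimensional ℝ E]
  [MeasurableSpace E] [BorelSpace E] [NormedAddCommGroup F] [NormedSpace ℝ F]

theorem lintegral_comp_homothety_le (μ : Measure E) [μ.IsAddHaarMeasure] {B : Set E}
    (hB : MeasurableSet B) (hconv : Convex ℝ B) {g : E → ENNReal} (hg : Measurable g)
    {t : ℝ} (ht : 1 / 2 ≤ t) (ht1 : t ≤ 1) {y : E} (hy : y ∈ B) :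
    ∫⁻ x in B, g ((1 - t) • y + t • x) ∂μ ≤ 2 ^ finrank ℝ E * ∫⁻ z in B, g z ∂μ := by
  have ht0 : 0 < t := by linarith
  have hm : Measurable fun z => B.indicator g ((1 - t) • y + z) :=
    (hg.indicator hB).comp (measurable_const_add _)
  calc ∫⁻ x in B, g ((1 - t) • y + t • x) ∂μ
      = ∫⁻ x in B, B.indicator g ((1 - t) • y + t • x) ∂μ := by
        refine setLIntegral_congr_fun hB fun x hx => ?_
        rw [indicator_of_mem (hconv hy hx (by linarith) ht0.le (by ring))]
    _ ≤ ∫⁻ x, B.indicator g ((1 - t) • y + t • x) ∂μ := setLIntegral_le_lintegral _ _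
    _ = ∫⁻ z, B.indicator g ((1 - t) • y + z) ∂(μ.map (t • ·)) :=
        (lintegral_map hm (measurable_const_smul t)).symm
    _ = ENNReal.ofReal |(t ^ finrank ℝ E)⁻¹| * ∫⁻ z in B, g z ∂μ := by
        rw [Measure.map_addHaar_smul μ ht0.ne', lintegral_smul_measure,
          lintegral_add_left_eq_self, lintegral_indicator hB, smul_eq_mul]
    _ ≤ 2 ^ finrank ℝ E * ∫⁻ z in B, g z ∂μ := by
        gcongr
        rw [← inv_pow, abs_of_pos (by positivity), ENNReal.ofReal_pow (by positivity)]
        gcongr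
        rw [← ENNReal.ofReal_ofNat 2]
        apply ENNReal.ofReal_le_ofReal
        rw [inv_le_comm₀ ht0 (by norm_num)]
        linarith

theorem lintegral_lintegral_comp_convexCombo_le (μ : Measure E) [μ.IsAddHaarMeasure] {B : Set E}
    (hB : MeasurableSet B) (hconv : Convex ℝ B) {g : E → ENNReal} (hg : Measurable g)
    {t : ℝ} (ht : t ∈ Icc (0 : ℝ) 1) :
    ∫⁻ x in B, ∫⁻ y in B, g ((1 - t) • y + t • x) ∂μ ∂μ
      ≤ μ B * (2 ^ finrank ℝ E * ∫⁻ z in B, g z ∂μ) := by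
  have aux {t : ℝ} (h : 1 / 2 ≤ t) (h1 : t ≤ 1) :
      ∫⁻ y in B, ∫⁻ x in B, g ((1 - t) • y + t • x) ∂μ ∂μ
        ≤ μ B * (2 ^ finrank ℝ E * ∫⁻ z in B, g z ∂μ) := by
    calc _ ≤ ∫⁻ y in B, (2 ^ finrank ℝ E * ∫⁻ z in B, g z ∂μ) ∂μ :=
          setLIntegral_mono measurable_const fun y hy =>
            lintegral_comp_homothety_le μ hB hconv hg h h1 hy
      _ = _ := by rw [setLIntegral_const, mul_comm]
  rcases le_total (1 / 2) t with h | h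
  · rw [lintegral_lintegral_swap (by fun_prop)]
    exact aux h ht.2
  · have := aux (t := 1 - t) (by linarith) (by linarith [ht.1])
    simpa [add_comm] using this

theorem enorm_integral_pow_le {α : Type*} [MeasurableSpace α] (μ : Measure α)
    [IsProbabilityMeasure μ] {f : α → F} (hf : AEStronglyMeasurable f μ) {k : ℕ} (hk : 1 ≤ k) :
    ‖∫ x, f x ∂μ‖ₑ ^ k ≤ ∫⁻ x, ‖f x‖ₑ ^ k ∂μ := by
  have h1 : ‖∫ x, f x ∂μ‖ₑ ≤ eLpNorm f (k : NNReal) μ := by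
    refine (enorm_integral_le_lintegral_enorm f).trans ?_
    rw [← eLpNorm_one_eq_lintegral_enorm]
    exact eLpNorm_le_eLpNorm_of_exponent_le (by exact_mod_cast hk) hf
  have h2 := eLpNorm_nnreal_pow_eq_lintegral (f := f) (μ := μ) (p := (k : NNReal))
    (by simp; omega)
  simp only [NNReal.coe_natCast, ENNReal.rpow_natCast] at h2
  rw [← h2]
  gcongr

theorem enorm_sub_sq_le_lintegral_fderiv [CompleteSpace F] {u : E → F} (hu : ContDiff ℝ 1 u)
    (x y : E) :
    ‖u x - u y‖ₑ ^ 2 ≤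
      ‖x - y‖ₑ ^ 2 * ∫⁻ t in Icc (0 : ℝ) 1, ‖fderiv ℝ u ((1 - t) • y + t • x)‖ₑ ^ 2 := by
  have hd : Continuous (fderiv ℝ u) := hu.continuous_fderiv (by norm_num)
  have hc : Continuous fun t : ℝ => fderiv ℝ u ((1 - t) • y + t • x) (x - y) := by fun_prop
  have hftc : ∫ t in (0 : ℝ)..1, fderiv ℝ u ((1 - t) • y + t • x) (x - y) = u x - u y := by
    have := intervalIntegral.integral_eq_sub_of_hasDerivAt
      (f := fun t : ℝ => u ((1 - t) • y + t • x)) (a := 0) (b := 1)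
      (f' := fun t => fderiv ℝ u ((1 - t) • y + t • x) (x - y)) (fun t _ => ?_)
      (hc.intervalIntegrable _ _)
    · simpa using this
    · have h1 : HasDerivAt (fun t : ℝ => (1 - t) • y + t • x) (x - y) t := by
        have := (((hasDerivAt_id t).const_sub 1).smul_const y).add
          ((hasDerivAt_id t).smul_const x)
        convert! this using 1
        simp only [neg_smul, one_smul]
        abel
      exact ((hu.differentiable (by norm_num)) _).hasFDerivAt.comp_hasDerivAt t h1
  have : IsProbabilityMeasure (volume.restrict (Ioc (0 : ℝ) 1)) := ⟨by simp⟩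
  rw [← hftc, intervalIntegral.integral_of_le zero_le_one, setLIntegral_congr Ioc_ae_eq_Icc.symm]
  refine (enorm_integral_pow_le _ hc.aestronglyMeasurable one_le_two).trans ?_
  rw [← lintegral_const_mul _ (by fun_prop)]
  refine lintegral_mono fun t => ?_
  rw [← mul_pow, mul_comm]
  gcongr
  exact ContinuousLinearMap.le_opENorm _ _

/-- The `L²` Poincaré inequality on a unit ball, in terms of differences. -/
theorem lintegral_lintegral_enorm_sub_sq_le [CompleteSpace F] (μ : Measure E)
    [μ.IsAddHaarMeasure] {u : E → F} (hu : ContDiff ℝ 1 u) :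
    ∫⁻ x in ball (0 : E) 1, ∫⁻ y in ball (0 : E) 1, ‖u x - u y‖ₑ ^ 2 ∂μ ∂μ ≤
      2 ^ 2 * (μ (ball 0 1) *
        (2 ^ finrank ℝ E * ∫⁻ z in ball (0 : E) 1, ‖fderiv ℝ u z‖ₑ ^ 2 ∂μ)) := by
  have hd : Continuous (fderiv ℝ u) := hu.continuous_fderiv (by norm_num)
  set B := ball (0 : E) 1
  have hB : MeasurableSet B := measurableSet_ball
  calc
    _ ≤ ∫⁻ x in B, ∫⁻ y in B, 2 ^ 2 *
          (∫⁻ t in Icc (0 : ℝ) 1, ‖fderiv ℝ u ((1 - t) • y + t • x)‖ₑ ^ 2) ∂μ ∂μ := by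
        refine setLIntegral_mono' hB fun x hx => setLIntegral_mono' hB fun y hy => ?_
        refine (enorm_sub_sq_le_lintegral_fderiv hu x y).trans ?_
        gcongr
        rw [← ofReal_norm, ← ENNReal.ofReal_ofNat 2]
        apply ENNReal.ofReal_le_ofReal
        have := norm_sub_le x y
        have hx' : ‖x‖ < 1 := by simpa [B] using hx
        have hy' : ‖y‖ < 1 := by simpa [B] using hy
        linarith
    _ = 2 ^ 2 * ∫⁻ t in Icc (0 : ℝ) 1, (∫⁻ x in B, ∫⁻ y in B,
          ‖fderiv ℝ u ((1 - t) • y + t • x)‖ₑ ^ 2 ∂μ ∂μ) := by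
        have h0 : (2 : ENNReal) ^ 2 ≠ ⊤ := by simp
        simp_rw [lintegral_const_mul' _ _ h0]
        congr 1
        rw [lintegral_lintegral_swap (μ := volume.restrict (Icc (0 : ℝ) 1))]
        · refine lintegral_congr fun x => lintegral_lintegral_swap ?_
          refine Measurable.aemeasurable ?_
          simp only [Function.uncurry_def]
          fun_prop
        · refine Measurable.aemeasurable ?_
          exact Measurable.lintegral_prod_right' (ν := μ.restrict B)
            (f := fun p : (ℝ × E) × E => ‖fderiv ℝ u ((1 - p.1.1) • p.2 + p.1.1 • p.1.2)‖ₑ ^ 2)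
            (by fun_prop)
    _ ≤ 2 ^ 2 * ∫⁻ t in Icc (0 : ℝ) 1, (μ B *
          (2 ^ finrank ℝ E * ∫⁻ z in B, ‖fderiv ℝ u z‖ₑ ^ 2 ∂μ)) := by
        gcongr 2 ^ 2 * ?_
        refine setLIntegral_mono' measurableSet_Icc fun t ht => ?_
        exact lintegral_lintegral_comp_convexCombo_le μ hB (convex_ball 0 1)
          (g := fun z => ‖fderiv ℝ u z‖ₑ ^ 2) (by fun_prop) ht
    _ = _ := by simp

/-- The `L²` Poincaré inequality on a unit ball. -/
theorem lintegral_enorm_sub_average_sq_le [CompleteSpace F] (μ : Measure E)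
    [μ.IsAddHaarMeasure] {u : E → F} (hu : ContDiff ℝ 1 u) :
    ∫⁻ x in ball (0 : E) 1, ‖u x - ⨍ y in ball (0 : E) 1, u y ∂μ‖ₑ ^ 2 ∂μ ≤
      2 ^ (finrank ℝ E + 2) * ∫⁻ z in ball (0 : E) 1, ‖fderiv ℝ u z‖ₑ ^ 2 ∂μ := by
  have hμ0 : μ (ball (0 : E) 1) ≠ 0 := (measure_ball_pos μ 0 one_pos).ne'
  have hμt : μ (ball (0 : E) 1) ≠ ⊤ := measure_ball_lt_top.ne
  set B := ball (0 : E) 1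
  have : NeZero (μ.restrict B) := ⟨by rwa [Ne, Measure.restrict_eq_zero]⟩
  have : IsFiniteMeasure (μ.restrict B) := ⟨by simpa using hμt.lt_top⟩
  have hint : Integrable u ((μ.restrict B univ)⁻¹ • μ.restrict B) := by
    refine Integrable.to_average ?_
    exact (hu.continuous.locallyIntegrable.integrableOn_isCompact
      (isCompact_closedBall 0 1)).mono_set ball_subset_closedBall
  have key (x : E) : ‖u x - ⨍ y in B, u y ∂μ‖ₑ ^ 2
      ≤ (μ B)⁻¹ * ∫⁻ y in B, ‖u x - u y‖ₑ ^ 2 ∂μ := by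
    have h := enorm_integral_pow_le ((μ.restrict B univ)⁻¹ • μ.restrict B)
      (f := fun y => u x - u y) (by
        have := hu.continuous
        exact Continuous.aestronglyMeasurable (by fun_prop)) one_le_two
    rw [integral_sub (integrable_const _) hint, integral_const, probReal_univ, one_smul,
      lintegral_smul_measure] at h
    simpa [average] using h
  calc _ ≤ ∫⁻ x in B, (μ B)⁻¹ * ∫⁻ y in B, ‖u x - u y‖ₑ ^ 2 ∂μ ∂μ := lintegral_mono key
    _ = (μ B)⁻¹ * ∫⁻ x in B, ∫⁻ y in B, ‖u x - u y‖ₑ ^ 2 ∂μ ∂μ :=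
        lintegral_const_mul' _ _ (by simpa using hμ0)
    _ ≤ (μ B)⁻¹ * (2 ^ 2 * (μ B *
        (2 ^ finrank ℝ E * ∫⁻ z in B, ‖fderiv ℝ u z‖ₑ ^ 2 ∂μ))) := by
        gcongr
        exact lintegral_lintegral_enorm_sub_sq_le μ hu
    _ = (μ B)⁻¹ * μ B * (2 ^ (finrank ℝ E + 2) * ∫⁻ z in B, ‖fderiv ℝ u z‖ₑ ^ 2 ∂μ) := by
        ring
    _ = _ := by rw [ENNReal.inv_mul_cancel hμ0 hμt, one_mul]

theorem eLpNorm_sub_average_le [CompleteSpace F] (μ : Measure E)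
    [μ.IsAddHaarMeasure] {u : E → F} (hu : ContDiff ℝ 1 u) :
    eLpNorm (fun x => u x - ⨍ y in ball (0 : E) 1, u y ∂μ) 2 (μ.restrict (ball 0 1)) ≤
      2 ^ (finrank ℝ E + 2) * eLpNorm (fderiv ℝ u) 2 (μ.restrict (ball 0 1)) := by
  have h1 := eLpNorm_nnreal_pow_eq_lintegral (p := 2) (μ := μ.restrict (ball 0 1))
    (f := fun x => u x - ⨍ y in ball (0 : E) 1, u y ∂μ) two_ne_zero
  have h2 := eLpNorm_nnreal_pow_eq_lintegral (p := 2) (μ := μ.restrict (ball 0 1))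
    (f := fderiv ℝ u) two_ne_zero
  simp only [NNReal.coe_ofNat, ENNReal.rpow_ofNat, ENNReal.coe_ofNat] at h1 h2
  rw [← ENNReal.pow_le_pow_left_iff two_ne_zero, mul_pow, h1, h2]
  refine (lintegral_enorm_sub_average_sq_le μ hu).trans ?_
  gcongr ?_ * _
  exact le_self_pow₀ (one_le_pow₀ (by norm_num)) two_ne_zero

/-- An interior Sobolev–Poincaré inequality. -/
theorem exists_eLpNorm_sub_average_le_eLpNorm_fderiv [FiniteDimensional ℝ F] (μ : Measure E)
    [μ.IsAddHaarMeasure] (hE : 2 < finrank ℝ E) {q : NNReal}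
    (hq : (2 : ℝ)⁻¹ - (finrank ℝ E : ℝ)⁻¹ ≤ (q : ℝ)⁻¹) :
    ∃ C : NNReal, ∀ u : E → F, ContDiff ℝ 1 u →
      eLpNorm (fun x => u x - ⨍ y in ball (0 : E) 1, u y ∂μ) q (μ.restrict (ball 0 (1 / 2))) ≤
        C * eLpNorm (fderiv ℝ u) 2 (μ.restrict (ball 0 1)) := by
  have : CompleteSpace F := FiniteDimensional.complete ℝ F
  let χ : ContDiffBump (0 : E) := ⟨1 / 2, 1, by norm_num, by norm_num⟩
  have hχ : ContDiff ℝ 1 χ := χ.contDiff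
  have hχd : Continuous (fderiv ℝ χ) := hχ.continuous_fderiv (by norm_num)
  obtain ⟨M, hM⟩ := (isCompact_closedBall (0 : E) 1).exists_bound_of_continuousOn
    hχd.continuousOn
  refine ⟨eLpNormLESNormFDerivOfLeConst F μ (ball 0 1) 2 q *
    (1 + M.toNNReal * 2 ^ (finrank ℝ E + 2)), fun u hu => ?_⟩
  set a := ⨍ y in ball (0 : E) 1, u y ∂μ
  set B := ball (0 : E) 1
  have hv : ContDiff ℝ 1 fun x => u x - a := hu.sub contDiff_const
  have hw : ContDiff ℝ 1 fun x => χ x • (u x - a) := hχ.smul hv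
  have hsupp : (Function.support fun x => χ x • (u x - a)) ⊆ B :=
    (Function.support_smul_subset_left _ _).trans χ.support_eq.subset
  have hfd (x : E) : fderiv ℝ (fun x => χ x • (u x - a)) x
      = χ x • fderiv ℝ u x + (fderiv ℝ χ x).smulRight (u x - a) := by
    rw [fderiv_fun_smul (hχ.differentiable (by norm_num) x) (hv.differentiable (by norm_num) x),
      fderiv_sub_const]
  have hud : Continuous (fderiv ℝ u) := hu.continuous_fderiv (by norm_num)
  have hgrad : eLpNorm (fderiv ℝ fun x => χ x • (u x - a)) 2 μ ≤
      eLpNorm (fderiv ℝ u) 2 (μ.restrict B) +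
        M.toNNReal * eLpNorm (fun x => u x - a) 2 (μ.restrict B) := by
    have hsupp' : (Function.support (fderiv ℝ fun x => χ x • (u x - a))) ⊆ closedBall 0 1 :=
      (support_fderiv_subset ℝ).trans
        (closure_minimal (hsupp.trans ball_subset_closedBall) isClosed_closedBall)
    have hae : μ.restrict (closedBall (0 : E) 1) = μ.restrict B :=
      Measure.restrict_congr_set (ae_eq_set.2 ⟨by
        rw [closedBall_sdiff_ball]; exact Measure.addHaar_sphere_of_ne_zero μ 0 one_ne_zero, by
        rw [sdiff_eq_empty.2 ball_subset_closedBall, measure_empty]⟩)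
    rw [← eLpNorm_restrict_eq_of_support_subset (ε := E →L[ℝ] F) hsupp', hae]
    calc eLpNorm (fderiv ℝ fun x => χ x • (u x - a)) 2 (μ.restrict B)
        ≤ eLpNorm (fun x => ‖fderiv ℝ u x‖ + M.toNNReal * ‖u x - a‖) 2 (μ.restrict B) := by
          refine eLpNorm_mono_ae_real ?_
          filter_upwards [ae_restrict_mem measurableSet_ball] with x hx
          rw [hfd]
          refine (norm_add_le _ _).trans ?_
          rw [norm_smul, ContinuousLinearMap.norm_smulRight_apply, Real.norm_of_nonneg χ.nonneg]
          gcongr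
          · exact mul_le_of_le_one_left (norm_nonneg _) χ.le_one
          · exact (hM x (ball_subset_closedBall hx)).trans (Real.le_coe_toNNReal M)
      _ ≤ eLpNorm (fun x => ‖fderiv ℝ u x‖) 2 (μ.restrict B) +
          eLpNorm (fun x => M.toNNReal * ‖u x - a‖) 2 (μ.restrict B) :=
          eLpNorm_add_le hud.norm.aestronglyMeasurable
            (hv.continuous.norm.const_mul _).aestronglyMeasurable one_le_two
      _ = _ := by
          rw [eLpNorm_norm]
          congr 1
          have := eLpNorm_const_smul (M.toNNReal : ℝ) (fun x => ‖u x - a‖) 2 (μ.restrict B)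
          rw [eLpNorm_norm] at this
          rw [Real.enorm_eq_ofReal NNReal.zero_le_coe, ENNReal.ofReal_coe_nnreal] at this
          exact this
  calc eLpNorm (fun x => u x - a) q (μ.restrict (ball 0 (1 / 2)))
      = eLpNorm (fun x => χ x • (u x - a)) q (μ.restrict (ball 0 (1 / 2))) := by
        refine eLpNorm_congr_ae ?_
        filter_upwards [ae_restrict_mem measurableSet_ball] with x hx
        rw [χ.one_of_mem_closedBall (ball_subset_closedBall hx), one_smul]
    _ ≤ eLpNorm (fun x => χ x • (u x - a)) q μ := eLpNorm_restrict_le _ _ _ _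
    _ ≤ eLpNormLESNormFDerivOfLeConst F μ B 2 q *
          eLpNorm (fderiv ℝ fun x => χ x • (u x - a)) (2 : NNReal) μ :=
        eLpNorm_le_eLpNorm_fderiv_of_le μ hw hsupp one_le_two (by exact_mod_cast hE)
          (by exact_mod_cast hq) isBounded_ball
    _ ≤ eLpNormLESNormFDerivOfLeConst F μ B 2 q * (eLpNorm (fderiv ℝ u) 2 (μ.restrict B) +
          M.toNNReal * (2 ^ (finrank ℝ E + 2) * eLpNorm (fderiv ℝ u) 2 (μ.restrict B))) := by
        gcongr
        refine hgrad.trans ?_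
        gcongr
        exact eLpNorm_sub_average_le μ hu
    _ = _ := by
        push_cast
        ring

end Poincare

theorem ofReal_integral_norm_pow {α F : Type*} [MeasurableSpace α] [NormedAddCommGroup F]
    {μ : Measure α} {f : α → F} {k : ℕ} (hk : k ≠ 0) (hf : Integrable (fun x => ‖f x‖ ^ k) μ) :
    ENNReal.ofReal (∫ x, ‖f x‖ ^ k ∂μ) = eLpNorm f (k : NNReal) μ ^ k := by
  have h := eLpNorm_nnreal_pow_eq_lintegral (f := f) (μ := μ) (p := (k : NNReal))
    (by exact_mod_cast hk)
  simp only [NNReal.coe_natCast, ENNReal.rpow_natCast] at h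
  rw [h, ofReal_integral_eq_lintegral_ofReal hf (ae_of_all _ fun x => by positivity)]
  simp_rw [ENNReal.ofReal_pow (norm_nonneg _), ofReal_norm]

theorem Continuous.integrableOn_ball {E F : Type*} [NormedAddCommGroup E]
    [NormedSpace ℝ E] [FiniteDimensional ℝ E] [MeasurableSpace E] [BorelSpace E]
    [NormedAddCommGroup F] {μ : Measure E} [IsLocallyFiniteMeasure μ] {f : E → F}
    (hf : Continuous f) (c : E) (r : ℝ) : IntegrableOn f (ball c r) μ :=
  (hf.locallyIntegrable.integrableOn_isCompact (isCompact_closedBall c r)).mono_set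
    ball_subset_closedBall

/-- The Sobolev–Poincaré inequality behind the one-step estimate, for `u` on the unit ball of `ℝ⁵`
and its mean over that ball. -/
theorem exists_sq_integral_norm_sub_average_pow_three_le :
    ∃ D : ℝ, 0 ≤ D ∧ ∀ u : EuclideanSpace ℝ (Fin 5) → EuclideanSpace ℝ (Fin 5),
      ContDiff ℝ 1 u → ∀ θ : ℝ, θ ≤ 1 / 2 →
        (∫ x in ball (0 : EuclideanSpace ℝ (Fin 5)) θ,
            ‖u x - ⨍ y in ball (0 : EuclideanSpace ℝ (Fin 5)) 1, u y‖ ^ 3) ^ 2 ≤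
          (D * ∫ x in ball (0 : EuclideanSpace ℝ (Fin 5)) 1, ‖fderiv ℝ u x‖ ^ 2) ^ 3 := by
  obtain ⟨C, hC⟩ := exists_eLpNorm_sub_average_le_eLpNorm_fderiv
    (E := EuclideanSpace ℝ (Fin 5)) (F := EuclideanSpace ℝ (Fin 5)) volume (q := 3)
    (by simp) (by simp; norm_num)
  refine ⟨C ^ 2, by positivity, fun u hu θ hθ => ?_⟩
  have huc := hu.continuous
  have hud : Continuous (fderiv ℝ u) := hu.continuous_fderiv (by norm_num)
  set a := ⨍ y in ball (0 : EuclideanSpace ℝ (Fin 5)) 1, u y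
  have hW := ofReal_integral_norm_pow (k := 3) three_ne_zero
    (Continuous.integrableOn_ball (μ := volume) (f := fun x => ‖u x - a‖ ^ 3) (by fun_prop)
      (0 : EuclideanSpace ℝ (Fin 5)) θ)
  have hG := ofReal_integral_norm_pow (k := 2) two_ne_zero
    (Continuous.integrableOn_ball (μ := volume) (f := fun x => ‖fderiv ℝ u x‖ ^ 2) (by fun_prop)
      (0 : EuclideanSpace ℝ (Fin 5)) 1)
  have hle : eLpNorm (fun x => u x - a) (3 : NNReal)
      (volume.restrict (ball (0 : EuclideanSpace ℝ (Fin 5)) θ)) ≤ C * eLpNorm (fderiv ℝ u) 2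
      (volume.restrict (ball (0 : EuclideanSpace ℝ (Fin 5)) 1)) :=
    (eLpNorm_mono_measure _ (Measure.restrict_mono (ball_subset_ball hθ) le_rfl)).trans (hC u hu)
  rw [← ENNReal.ofReal_le_ofReal_iff (by positivity), ENNReal.ofReal_pow (by positivity),
    ENNReal.ofReal_pow (by positivity), ENNReal.ofReal_mul (by positivity), hW, hG,
    ENNReal.ofReal_pow (by positivity), ENNReal.ofReal_coe_nnreal, ← mul_pow, ← pow_mul, ← pow_mul]
  exact pow_le_pow_left' hle 6

theorem norm_average_pow_mul_le {α F : Type*} [MeasurableSpace α] [NormedAddCommGroup F]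
    [NormedSpace ℝ F] [CompleteSpace F] {μ : Measure α} [IsFiniteMeasure μ] [NeZero μ]
    {f : α → F} (hf : Integrable f μ) {k : ℕ} (hfk : Integrable (fun x => ‖f x‖ ^ k) μ) :
    ‖⨍ x, f x ∂μ‖ ^ k * μ.real univ ≤ ∫ x, ‖f x‖ ^ k ∂μ := by
  have h := ((convexOn_norm (E := F) convex_univ).pow (fun _ _ => norm_nonneg _) k).map_average_le
    (by fun_prop) isClosed_univ (by simp) hf hfk
  have hpos : 0 < μ.real univ := measureReal_univ_pos
  rwa [average_eq μ (fun x => (norm ^ k) (f x)), smul_eq_mul, ← div_eq_inv_mul, le_div_iff₀ hpos] at h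

/-- There exist constants `C > 0` and `ε > 0` depending only on `s ∈ (1,2)`
such that for `u ∈ H¹(B_1) ∩ L³(B_1)` in `ℝ⁵` and `0 < θ ≤ 1/2`, if
`C θ^{3(6s-8)} C(1) ≤ 1/6`, then
`C(θ) ≤ C θ^{6s-3} C(1) + C θ^{3(6s-8)} C(1) B(1) + C B(1)`. -/
theorem stmt_12 (s : ℝ) (hs1 : 1 < s) (hs2 : s < 2) :
    ∃ C ε : ℝ, 0 < C ∧ 0 < ε ∧
      ∀ u : EuclideanSpace ℝ (Fin 5) → EuclideanSpace ℝ (Fin 5),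
        ContDiff ℝ 1 u →
        IntegrableOn (fun x => ‖u x‖ ^ 3) (ball (0 : EuclideanSpace ℝ (Fin 5)) 1) →
        IntegrableOn (fun x => ‖fderiv ℝ u x‖ ^ 2) (ball (0 : EuclideanSpace ℝ (Fin 5)) 1) →
        ∀ θ : ℝ, 0 < θ → θ ≤ 1 / 2 →
          C * θ ^ (3 * (6 * s - 8)) * Cq s u 1 ≤ 1 / 6 →
          Cq s u θ ≤ C * θ ^ (6 * s - 3) * Cq s u 1
              + C * θ ^ (3 * (6 * s - 8)) * Cq s u 1 * Bq s u 1
              + C * Bq s u 1 := by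
  obtain ⟨D, hD, hSP⟩ := exists_sq_integral_norm_sub_average_pow_three_le
  refine ⟨4 + 8 * D, 1, by positivity, one_pos, fun u hu hu3 _ θ hθ hθ2 hsmall => ?_⟩
  have huc := hu.continuous
  have hW := hSP u hu θ hθ2
  simp only [Cq, Bq, Real.one_rpow, one_mul] at hsmall ⊢
  set B := ball (0 : EuclideanSpace ℝ (Fin 5)) 1
  set Bθ := ball (0 : EuclideanSpace ℝ (Fin 5)) θ
  set a := ⨍ y in B, u y
  set K := ∫ x in B, ‖u x‖ ^ 3
  set G := ∫ x in B, ‖fderiv ℝ u x‖ ^ 2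
  set L := ∫ x in Bθ, ‖u x‖ ^ 3
  set W := ∫ x in Bθ, ‖u x - a‖ ^ 3
  have hK : 0 ≤ K := integral_nonneg fun x => by positivity
  have hG : 0 ≤ G := integral_nonneg fun x => by positivity
  have hW0 : 0 ≤ W := integral_nonneg fun x => by positivity
  have hLK : L ≤ K := setIntegral_mono_set hu3 (ae_of_all _ fun x => by positivity)
    (ball_subset_ball (by linarith)).eventuallyLE
  have hLi : IntegrableOn (fun x => ‖u x‖ ^ 3) Bθ := Continuous.integrableOn_ball (by fun_prop) _ _
  have hWi : IntegrableOn (fun x => ‖u x - a‖ ^ 3) Bθ :=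
    Continuous.integrableOn_ball (by fun_prop) _ _
  have hconst : IntegrableOn (fun _ => ‖a‖ ^ 3) Bθ :=
    Continuous.integrableOn_ball continuous_const _ _
  have hvol : volume.real Bθ = θ ^ 5 * volume.real B := by
    have := Measure.addHaar_ball_mul_of_pos (volume : Measure (EuclideanSpace ℝ (Fin 5))) 0 hθ 1
    rw [mul_one, finrank_euclideanSpace_fin] at this
    rw [measureReal_def, this, ENNReal.toReal_mul, ENNReal.toReal_ofReal (by positivity),
      measureReal_def]
  have haK : ‖a‖ ^ 3 * volume.real B ≤ K := by
    have : NeZero (volume.restrict B) :=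
      ⟨by rw [Ne, Measure.restrict_eq_zero]; exact (measure_ball_pos _ _ one_pos).ne'⟩
    have : IsFiniteMeasure (volume.restrict B) := ⟨by simpa using measure_ball_lt_top⟩
    simpa using norm_average_pow_mul_le (huc.integrableOn_ball _ _) hu3
  have hconst_eq : ∫ _ in Bθ, ‖a‖ ^ 3 = θ ^ 5 * (‖a‖ ^ 3 * volume.real B) := by
    rw [setIntegral_const, smul_eq_mul, hvol]
    ring
  have hconst_le : ∫ _ in Bθ, ‖a‖ ^ 3 ≤ θ ^ 5 * K := by
    rw [hconst_eq]
    gcongr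
  have hWK : W ≤ 8 * K := by
    have h : W ≤ 4 * (L + ∫ _ in Bθ, ‖a‖ ^ 3) := by
      rw [← integral_add hLi hconst, ← integral_const_mul]
      refine integral_mono hWi ((hLi.add hconst).const_mul 4) fun x => ?_
      refine (pow_le_pow_left₀ (norm_nonneg _) (norm_sub_le (u x) a) 3).trans ?_
      refine (add_pow_le (norm_nonneg _) (norm_nonneg _) 3).trans_eq ?_
      norm_num
    have : θ ^ 5 * K ≤ K := mul_le_of_le_one_left hK (pow_le_one₀ hθ.le (by linarith))
    linarith
  have hLW : L ≤ 4 * (W + ∫ _ in Bθ, ‖a‖ ^ 3) := by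
    rw [← integral_add hWi hconst, ← integral_const_mul]
    refine integral_mono hLi ((hWi.add hconst).const_mul 4) fun x => ?_
    refine (pow_le_pow_left₀ (norm_nonneg _) (norm_le_norm_sub_add (u x) a) 3).trans ?_
    refine (add_pow_le (norm_nonneg _) (norm_nonneg _) 3).trans_eq ?_
    norm_num
  set p := θ ^ (6 * s - 8)
  have hp : 0 < p := Real.rpow_pos_of_pos hθ _
  have e1 : θ ^ (-8 + 6 * s) = p := by rw [neg_add_eq_sub]
  have e3 : θ ^ (3 * (6 * s - 8)) = p ^ 3 := by
    rw [mul_comm, Real.rpow_mul hθ.le]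
    norm_cast
  have e5 : θ ^ (6 * s - 3) = p * θ ^ 5 := by
    rw [← Real.rpow_natCast θ 5, ← Real.rpow_add hθ]
    norm_num
    ring_nf
  rw [e1, e3, e5]
  rw [e3] at hsmall
  have hpK : p ^ 3 * K ≤ 1 := by
    have : 0 ≤ p ^ 3 * K := by positivity
    nlinarith
  have hpW : p * W ≤ 2 * D * G := by
    refine le_of_pow_le_pow_left₀ three_ne_zero (by positivity) ?_
    calc (p * W) ^ 3 = p ^ 3 * (W * W ^ 2) := by ring
      _ ≤ p ^ 3 * ((8 * K) * (D * G) ^ 3) := by gcongr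
      _ = 8 * (p ^ 3 * K) * (D * G) ^ 3 := by ring
      _ ≤ 8 * 1 * (D * G) ^ 3 := by gcongr
      _ = (2 * D * G) ^ 3 := by ring
  calc p * L ≤ p * (4 * (W + θ ^ 5 * K)) := by
        gcongr
        linarith
    _ = 4 * (p * θ ^ 5) * K + 4 * (p * W) := by ring
    _ ≤ 4 * (p * θ ^ 5) * K + 4 * (2 * D * G) := by gcongr
    _ ≤ 4 * (p * θ ^ 5) * K + 8 * D * (p * θ ^ 5) * K + (4 + 8 * D) * p ^ 3 * K * G +
        (4 * G + 4 * (2 * D * G)) := by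
        have h1 : 0 ≤ 8 * D * (p * θ ^ 5) * K := by positivity
        have h2 : 0 ≤ (4 + 8 * D) * p ^ 3 * K * G := by positivity
        linarith
    _ = _ := by ring
end
end

section
/- Let s ∈ (1,2), b = 3−2s, n ≥ 1. If u ∈ L²(B_2) ∩ L¹_loc(ℝ^n) satisfies N := sup_{R ≥ 1} R^{−3s}(⨍_{B_R}|u| dx)² < ∞, then the Poisson-type extension u*(x,y) = ∫_{ℝ^n} P(x−ξ, y) u(ξ) dξ with kernel P(x,y) = c̄_{n,s} y^{2s} (|x|² + y²)^{−(n+2s)/2} is well-defined, belongs to L²(B_1^+, y^b), and satisfies ∫_{B_1^+} y^b |u*|² dx dy ≤ C(∫_{B_2}|u|² dx + N) for a constant C depending on n and s. -/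
open MeasureTheory Metric Filter Set
open scoped ENNReal

noncomputable section

/-- The Poisson-type kernel `P(x,y) = c̄ y^{2s} (|x|² + y²)^{-(n+2s)/2}` of the R. Yang
extension. -/
def Pker (n : ℕ) (s cbar : ℝ) (x : EuclideanSpace ℝ (Fin n)) (y : ℝ) : ℝ :=
  cbar * y ^ (2 * s) * (‖x‖ ^ 2 + y ^ 2) ^ (-((n : ℝ) + 2 * s) / 2)

lemma measurable_uncurry_Pker (n : ℕ) (s cbar : ℝ) :
    Measurable fun p : EuclideanSpace ℝ (Fin n) × ℝ => Pker n s cbar p.1 p.2 := by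
  unfold Pker
  fun_prop

lemma Pker_nonneg {n : ℕ} {s cbar : ℝ} (hc : 0 ≤ cbar) (x : EuclideanSpace ℝ (Fin n))
    {y : ℝ} (hy : 0 ≤ y) : 0 ≤ Pker n s cbar x y := by
  unfold Pker
  positivity

lemma Pker_le_of_le_norm {n : ℕ} {s cbar : ℝ} (hs : 0 ≤ s) (hc : 0 ≤ cbar)
    {x : EuclideanSpace ℝ (Fin n)} {y r : ℝ} (hy : 0 ≤ y) (hy1 : y ≤ 1) (hr : 0 < r)
    (hx : r ^ 2 ≤ ‖x‖ ^ 2 + y ^ 2) :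
    Pker n s cbar x y ≤ cbar * r ^ (-((n : ℝ) + 2 * s)) := by
  have h1 : y ^ (2 * s) ≤ 1 := Real.rpow_le_one hy hy1 (by positivity)
  have h2 : (‖x‖ ^ 2 + y ^ 2) ^ (-((n : ℝ) + 2 * s) / 2) ≤ r ^ (-((n : ℝ) + 2 * s)) := by
    calc (‖x‖ ^ 2 + y ^ 2) ^ (-((n : ℝ) + 2 * s) / 2)
        ≤ (r ^ 2) ^ (-((n : ℝ) + 2 * s) / 2) := by
          refine Real.rpow_le_rpow_of_nonpos (by positivity) hx ?_
          have : (0 : ℝ) ≤ n + 2 * s := by positivity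
          linarith
      _ = r ^ (-((n : ℝ) + 2 * s)) := by
          rw [← Real.rpow_natCast, ← Real.rpow_mul hr.le]
          congr 1
          push_cast
          ring
  unfold Pker
  rw [mul_assoc]
  refine mul_le_mul_of_nonneg_left ?_ hc
  calc y ^ (2 * s) * (‖x‖ ^ 2 + y ^ 2) ^ (-((n : ℝ) + 2 * s) / 2)
      ≤ 1 * r ^ (-((n : ℝ) + 2 * s)) := by gcongr
    _ = _ := one_mul _

/-- Jensen's inequality for the square with respect to a subprobability density `w`. -/
lemma sq_lintegral_mul_le_of_lintegral_le_one {α : Type*} [MeasurableSpace α] {μ : Measure α}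
    {w f : α → ℝ≥0∞} (hw : Measurable w) (hf : Measurable f) (hw1 : ∫⁻ a, w a ∂μ ≤ 1) :
    (∫⁻ a, w a * f a ∂μ) ^ 2 ≤ ∫⁻ a, w a * f a ^ 2 ∂μ := by
  have h := ENNReal.lintegral_mul_le_Lp_mul_Lq (μ.withDensity w) Real.HolderConjugate.two_two
    hf.aemeasurable (measurable_const (a := (1 : ℝ≥0∞))).aemeasurable
  have e1 : ∫⁻ a, (f * fun _ => 1 : α → ℝ≥0∞) a ∂(μ.withDensity w) = ∫⁻ a, w a * f a ∂μ := by
    rw [lintegral_withDensity_eq_lintegral_mul _ hw (by fun_prop)]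
    simp
  have e2 : ∫⁻ a, f a ^ (2 : ℝ) ∂(μ.withDensity w) = ∫⁻ a, w a * f a ^ 2 ∂μ := by
    rw [lintegral_withDensity_eq_lintegral_mul _ hw (by fun_prop)]
    simp
  have e3 : ∫⁻ _, (1 : ℝ≥0∞) ^ (2 : ℝ) ∂(μ.withDensity w) = ∫⁻ a, w a ∂μ := by
    rw [lintegral_withDensity_eq_lintegral_mul _ hw (by fun_prop)]
    simp
  rw [e1, e2, e3] at h
  have h' : ∫⁻ a, w a * f a ∂μ ≤ (∫⁻ a, w a * f a ^ 2 ∂μ) ^ (1 / 2 : ℝ) :=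
    h.trans (mul_le_of_le_one_right' (ENNReal.rpow_le_one hw1 (by norm_num)))
  calc (∫⁻ a, w a * f a ∂μ) ^ 2
      ≤ ((∫⁻ a, w a * f a ^ 2 ∂μ) ^ (1 / 2 : ℝ)) ^ 2 := by gcongr
    _ = ∫⁻ a, w a * f a ^ 2 ∂μ := by
      rw [← ENNReal.rpow_natCast, ← ENNReal.rpow_mul]
      norm_num

/-- Young's inequality `L¹ * L² → L²` for a subprobability kernel. -/
lemma lintegral_sq_lintegral_sub_mul_le {G : Type*} [AddGroup G] [MeasurableSpace G]
    [MeasurableAdd₂ G] [MeasurableNeg G] {μ : Measure G} [SFinite μ] [μ.IsAddLeftInvariant]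
    [μ.IsAddRightInvariant] [μ.IsNegInvariant] {k f : G → ℝ≥0∞} (hk : Measurable k)
    (hf : Measurable f) (hk1 : ∫⁻ a, k a ∂μ ≤ 1) :
    ∫⁻ x, (∫⁻ ξ, k (x - ξ) * f ξ ∂μ) ^ 2 ∂μ ≤ ∫⁻ ξ, f ξ ^ 2 ∂μ := by
  calc ∫⁻ x, (∫⁻ ξ, k (x - ξ) * f ξ ∂μ) ^ 2 ∂μ
      ≤ ∫⁻ x, ∫⁻ ξ, k (x - ξ) * f ξ ^ 2 ∂μ ∂μ := by
        refine lintegral_mono fun x => ?_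
        refine sq_lintegral_mul_le_of_lintegral_le_one (by fun_prop) hf ?_
        rwa [lintegral_sub_left_eq_self k x]
    _ = ∫⁻ ξ, ∫⁻ x, k (x - ξ) * f ξ ^ 2 ∂μ ∂μ := by
        refine lintegral_lintegral_swap (Measurable.aemeasurable ?_)
        unfold Function.uncurry
        fun_prop
    _ ≤ ∫⁻ ξ, f ξ ^ 2 ∂μ := by
        refine lintegral_mono fun ξ => ?_
        rw [lintegral_mul_const _ (by fun_prop), lintegral_sub_right_eq_self k ξ]
        exact mul_le_of_le_one_left' hk1

/-- Pointwise bound on the unit half-ball for the extension of a function which lives outside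
`B_2` and has controlled growth. -/
lemma lintegral_compl_ball_Pker_mul_le {n : ℕ} {s cbar D : ℝ} (hs : 0 < s) (hc : 0 ≤ cbar)
    (hD : 0 ≤ D) {f : EuclideanSpace ℝ (Fin n) → ℝ≥0∞}
    (hgrowth : ∀ R : ℝ, 1 ≤ R →
      ∫⁻ ξ in ball 0 R, f ξ ≤ ENNReal.ofReal (D * R ^ ((n : ℝ) + 3 * s / 2)))
    {x : EuclideanSpace ℝ (Fin n)} {y : ℝ} (hx : ‖x‖ < 1) (hy : y ∈ Ioo (0 : ℝ) 1) :
    ∫⁻ ξ in (ball 0 2)ᶜ, ENNReal.ofReal (Pker n s cbar (x - ξ) y) * f ξ ≤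
      ENNReal.ofReal
        (cbar * D * 4 ^ ((n : ℝ) + 3 * s / 2) * (1 - (2 : ℝ) ^ (-(s / 2)))⁻¹) := by
  set q : ℝ := (2 : ℝ) ^ (-(s / 2)) with hq
  have hq0 : 0 ≤ q := by positivity
  have hq1 : q < 1 := Real.rpow_lt_one_of_one_lt_of_neg (by norm_num) (by linarith)
  set A : ℝ := cbar * D * 4 ^ ((n : ℝ) + 3 * s / 2) with hA
  have hA0 : 0 ≤ A := by positivity
  let S : ℕ → Set (EuclideanSpace ℝ (Fin n)) :=
    fun k => {ξ | (2 : ℝ) ^ (k + 1) ≤ ‖ξ‖ ∧ ‖ξ‖ < 2 ^ (k + 2)}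
  have hS : ∀ k, MeasurableSet (S k) := fun k =>
    (measurableSet_le measurable_const measurable_norm).inter
      (measurableSet_lt measurable_norm measurable_const)
  have hcover : (ball (0 : EuclideanSpace ℝ (Fin n)) 2)ᶜ ⊆ ⋃ k, S k := by
    intro ξ hξ
    have hξ2 : 2 ≤ ‖ξ‖ := by simpa using hξ
    obtain ⟨k, h1, h2⟩ := exists_nat_pow_near (x := ‖ξ‖ / 2) (y := (2 : ℝ)) (by linarith)
      (by norm_num)
    refine mem_iUnion.2 ⟨k, ?_, ?_⟩
    · rw [pow_succ]; linarith
    · rw [pow_succ]; linarith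
  have hpow : ∀ k : ℕ, cbar * ((2 : ℝ) ^ k) ^ (-((n : ℝ) + 2 * s)) *
      (D * ((2 : ℝ) ^ (k + 2)) ^ ((n : ℝ) + 3 * s / 2)) = A * q ^ k := by
    intro k
    have h2k : (0 : ℝ) < 2 ^ k := by positivity
    have e1 : ((2 : ℝ) ^ (k + 2)) ^ ((n : ℝ) + 3 * s / 2) =
        ((2 : ℝ) ^ k) ^ ((n : ℝ) + 3 * s / 2) * 4 ^ ((n : ℝ) + 3 * s / 2) := by
      rw [pow_add, Real.mul_rpow h2k.le (by norm_num)]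
      norm_num
    have e2 : ((2 : ℝ) ^ k) ^ (-((n : ℝ) + 2 * s)) * ((2 : ℝ) ^ k) ^ ((n : ℝ) + 3 * s / 2) =
        q ^ k := by
      rw [← Real.rpow_add h2k, hq, ← Real.rpow_natCast, ← Real.rpow_natCast,
        ← Real.rpow_mul (by norm_num), ← Real.rpow_mul (by norm_num)]
      congr 1
      ring
    rw [e1, ← e2, hA]
    ring
  have hshell : ∀ k, ∫⁻ ξ in S k, ENNReal.ofReal (Pker n s cbar (x - ξ) y) * f ξ ≤
      ENNReal.ofReal (A * q ^ k) := by
    intro k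
    have h1 : (1 : ℝ) ≤ 2 ^ k := one_le_pow₀ (by norm_num)
    calc ∫⁻ ξ in S k, ENNReal.ofReal (Pker n s cbar (x - ξ) y) * f ξ
        ≤ ∫⁻ ξ in S k,
            ENNReal.ofReal (cbar * ((2 : ℝ) ^ k) ^ (-((n : ℝ) + 2 * s))) * f ξ := by
          refine setLIntegral_mono' (hS k) fun ξ hξ => ?_
          gcongr
          refine Pker_le_of_le_norm hs.le hc hy.1.le hy.2.le (by positivity) ?_
          have h3 : ‖ξ‖ - ‖x‖ ≤ ‖x - ξ‖ := by
            rw [norm_sub_rev]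
            exact norm_sub_norm_le ξ x
          have h4 : (2 : ℝ) ^ k ≤ ‖x - ξ‖ := by
            have := hξ.1
            rw [pow_succ] at this
            linarith
          have := pow_le_pow_left₀ (by positivity) h4 2
          nlinarith [sq_nonneg y]
      _ = ENNReal.ofReal (cbar * ((2 : ℝ) ^ k) ^ (-((n : ℝ) + 2 * s))) *
            ∫⁻ ξ in S k, f ξ := lintegral_const_mul' _ _ ENNReal.ofReal_ne_top
      _ ≤ ENNReal.ofReal (cbar * ((2 : ℝ) ^ k) ^ (-((n : ℝ) + 2 * s))) *
            ENNReal.ofReal (D * ((2 : ℝ) ^ (k + 2)) ^ ((n : ℝ) + 3 * s / 2)) := by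
          gcongr
          refine (lintegral_mono_set fun ξ hξ => ?_).trans
            (hgrowth (2 ^ (k + 2)) (one_le_pow₀ (by norm_num)))
          simpa using hξ.2
      _ = ENNReal.ofReal (A * q ^ k) := by
          rw [← ENNReal.ofReal_mul (by positivity), hpow]
  calc ∫⁻ ξ in (ball 0 2)ᶜ, ENNReal.ofReal (Pker n s cbar (x - ξ) y) * f ξ
      ≤ ∫⁻ ξ in ⋃ k, S k, ENNReal.ofReal (Pker n s cbar (x - ξ) y) * f ξ :=
        lintegral_mono_set hcover
    _ ≤ ∑' k, ∫⁻ ξ in S k, ENNReal.ofReal (Pker n s cbar (x - ξ) y) * f ξ :=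
        lintegral_iUnion_le _ _
    _ ≤ ∑' k, ENNReal.ofReal (A * q ^ k) := ENNReal.tsum_le_tsum hshell
    _ = ENNReal.ofReal (A * (1 - q)⁻¹) := by
        rw [← ENNReal.ofReal_tsum_of_nonneg (fun k => by positivity)
          ((summable_geometric_of_lt_one hq0 hq1).mul_left A), tsum_mul_left,
          tsum_geometric_of_lt_one hq0 hq1]

/-- A bound on the weighted squared averages of `|u|` controls its integral over balls. -/
lemma lintegral_ball_enorm_le_of_average_le {n : ℕ} {s N R : ℝ}
    {u : EuclideanSpace ℝ (Fin n) → ℝ} (hR : 0 < R)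
    (hu : IntegrableOn u (ball (0 : EuclideanSpace ℝ (Fin n)) R))
    (h : R ^ (-(3 * s)) * (⨍ x in ball (0 : EuclideanSpace ℝ (Fin n)) R, |u x|) ^ 2 ≤ N) :
    ∫⁻ ξ in ball 0 R, ‖u ξ‖ₑ ≤
      ENNReal.ofReal (volume.real (ball (0 : EuclideanSpace ℝ (Fin n)) 1) * √N *
        R ^ ((n : ℝ) + 3 * s / 2)) := by
  have hvol : volume.real (ball (0 : EuclideanSpace ℝ (Fin n)) R) =
      R ^ (n : ℝ) * volume.real (ball (0 : EuclideanSpace ℝ (Fin n)) 1) := by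
    rw [measureReal_def, Measure.addHaar_ball_of_pos _ _ hR, ENNReal.toReal_mul,
      ENNReal.toReal_ofReal (by positivity), finrank_euclideanSpace_fin, Real.rpow_natCast,
      measureReal_def]
  have havg : ⨍ x in ball (0 : EuclideanSpace ℝ (Fin n)) R, |u x| ≤ √N * R ^ (3 * s / 2) := by
    rw [Real.rpow_neg hR.le, ← div_eq_inv_mul, div_le_iff₀ (by positivity)] at h
    have hN : 0 ≤ N := by
      by_contra hN
      have : N * R ^ (3 * s) < 0 := mul_neg_of_neg_of_pos (not_le.1 hN) (by positivity)
      nlinarith [sq_nonneg (⨍ x in ball (0 : EuclideanSpace ℝ (Fin n)) R, |u x|)]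
    refine abs_le_of_sq_le_sq' ?_ (by positivity) |>.2
    rw [mul_pow, Real.sq_sqrt hN, ← Real.rpow_natCast (R ^ _), ← Real.rpow_mul hR.le]
    convert h using 3
    push_cast
    ring
  have hpos : 0 < volume.real (ball (0 : EuclideanSpace ℝ (Fin n)) R) :=
    ENNReal.toReal_pos (measure_ball_pos _ _ hR).ne' measure_ball_lt_top.ne
  rw [setAverage_eq, smul_eq_mul, inv_mul_le_iff₀ hpos, hvol] at havg
  rw [← ofReal_integral_norm_eq_lintegral_enorm hu]
  refine ENNReal.ofReal_le_ofReal (havg.trans_eq ?_)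
  rw [Real.rpow_add hR]
  ring

lemma setLIntegral_Ico_rpow {b : ℝ} (hb : -1 < b) :
    ∫⁻ y in Ico (0 : ℝ) 1, ENNReal.ofReal (y ^ b) = ENNReal.ofReal (1 / (b + 1)) := by
  rw [restrict_Ico_eq_restrict_Ioc, ← ofReal_integral_eq_lintegral_ofReal,
    ← intervalIntegral.integral_of_le zero_le_one, integral_rpow (Or.inl hb)]
  · rw [Real.one_rpow, Real.zero_rpow (by linarith), sub_zero]
  · exact (intervalIntegral.intervalIntegrable_rpow' hb).1
  · exact (ae_restrict_mem measurableSet_Ioc).mono fun y hy => Real.rpow_nonneg hy.1.le _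

/-- Lemma 3.4 of Colombo–De Lellis–Massaccesi.  Let `s ∈ (1,2)`,
`b = 3-2s`.  If `u ∈ L²(B_2) ∩ L¹_loc(ℝⁿ)` with `N = sup_{R ≥ 1} R^{-3s} (⨍_{B_R}|u|)² < ∞`,
then the extension `u*(x,y) = ∫ P(x-ξ,y) u(ξ) dξ` is well defined on `B_1^+ = B_1 × [0,1)`,
belongs to `L²(B_1^+, y^b)`, and
`∫_{B_1^+} y^b |u*|² ≤ C (∫_{B_2}|u|² + N)` with `C = C(n,s)`. -/
theorem stmt_19 (n : ℕ) (hn : 1 ≤ n) (s : ℝ) (hs1 : 1 < s) (hs2 : s < 2) :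
    ∃ C : ℝ, 0 < C ∧
      ∀ (cbar : ℝ) (u : EuclideanSpace ℝ (Fin n) → ℝ) (N : ℝ),
        0 < cbar →
        (∀ y : ℝ, 0 < y → ∫ x, Pker n s cbar x y = 1) →
        AEStronglyMeasurable u volume →
        (∀ R : ℝ, 0 < R → IntegrableOn u (ball (0 : EuclideanSpace ℝ (Fin n)) R)) →
        IntegrableOn (fun x => (u x) ^ 2) (ball (0 : EuclideanSpace ℝ (Fin n)) 2) →
        0 ≤ N →
        (∀ R : ℝ, 1 ≤ R →
          R ^ (-(3 * s)) * (⨍ x in ball (0 : EuclideanSpace ℝ (Fin n)) R, |u x|) ^ 2 ≤ N) →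
        (∀ (x : EuclideanSpace ℝ (Fin n)) (y : ℝ), ‖x‖ < 1 → y ∈ Set.Ioo (0 : ℝ) 1 →
          Integrable (fun ξ => Pker n s cbar (x - ξ) y * u ξ)) ∧
        (∫⁻ p in ball (0 : EuclideanSpace ℝ (Fin n)) 1 ×ˢ Set.Ico (0 : ℝ) 1,
            ENNReal.ofReal (p.2 ^ (3 - 2 * s) *
              (∫ ξ, Pker n s cbar (p.1 - ξ) p.2 * u ξ) ^ 2))
          ≤ ENNReal.ofReal (C *
              ((∫ x in ball (0 : EuclideanSpace ℝ (Fin n)) 2, (u x) ^ 2) + N)) := by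
  set V : ℝ := volume.real (ball (0 : EuclideanSpace ℝ (Fin n)) 1)
  set κ : ℝ := (∫ x : EuclideanSpace ℝ (Fin n), Pker n s 1 x 1)⁻¹
  set A : ℝ := κ * V * 4 ^ ((n : ℝ) + 3 * s / 2) * (1 - (2 : ℝ) ^ (-(s / 2)))⁻¹ with hA
  have hV0 : 0 ≤ V := measureReal_nonneg
  have hb : 0 < 4 - 2 * s := by linarith
  refine ⟨4 / (4 - 2 * s) * (1 + A ^ 2 * V), by positivity, ?_⟩
  intro cbar u N hc hP hu hloc hsq hN hgrowth
  have hcκ : cbar = κ := by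
    have h : cbar * ∫ x : EuclideanSpace ℝ (Fin n), Pker n s 1 x 1 = 1 := by
      refine Eq.trans ?_ (hP 1 one_pos)
      rw [← integral_const_mul]
      simp only [Pker, one_mul, mul_assoc]
    exact eq_inv_of_mul_eq_one_left h
  have hK : ∀ y : ℝ, 0 < y →
      ∫⁻ x : EuclideanSpace ℝ (Fin n), ENNReal.ofReal (Pker n s cbar x y) ≤ 1 := by
    intro y hy
    have hint : Integrable fun x : EuclideanSpace ℝ (Fin n) => Pker n s cbar x y := by
      by_contra h
      exact zero_ne_one ((integral_undef h).symm.trans (hP y hy))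
    rw [← ofReal_integral_eq_lintegral_ofReal hint
      (Eventually.of_forall fun x => Pker_nonneg hc.le x hy.le), hP y hy, ENNReal.ofReal_one]
  have hmeas := measurable_uncurry_Pker n s cbar
  have hmeas2 : Measurable fun p : (EuclideanSpace ℝ (Fin n) × ℝ) × EuclideanSpace ℝ (Fin n) =>
      Pker n s cbar (p.1.1 - p.2) p.1.2 :=
    hmeas.comp (g := fun p : EuclideanSpace ℝ (Fin n) × ℝ => Pker n s cbar p.1 p.2)
      (f := fun p : (EuclideanSpace ℝ (Fin n) × ℝ) × EuclideanSpace ℝ (Fin n) =>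
        (p.1.1 - p.2, p.1.2)) (by fun_prop)
  have hmeasy : ∀ y, Measurable fun x : EuclideanSpace ℝ (Fin n) => Pker n s cbar x y :=
    fun y => hmeas.comp (g := fun p : EuclideanSpace ℝ (Fin n) × ℝ => Pker n s cbar p.1 p.2)
      (measurable_id.prodMk measurable_const)
  obtain ⟨f, hf, hfu⟩ : ∃ f : EuclideanSpace ℝ (Fin n) → ℝ≥0∞, Measurable f ∧
      (fun ξ => ‖u ξ‖ₑ) =ᵐ[volume] f := ⟨_, hu.enorm.measurable_mk, hu.enorm.ae_eq_mk⟩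
  have hfball : ∀ R : ℝ, ∫⁻ ξ in ball 0 R, f ξ = ∫⁻ ξ in ball 0 R, ‖u ξ‖ₑ := fun R =>
    lintegral_congr_ae (ae_restrict_of_ae hfu.symm)
  have hfsq : ∫⁻ ξ in ball 0 2, f ξ ^ 2 = ENNReal.ofReal (∫ x in ball 0 2, (u x) ^ 2) := by
    rw [ofReal_integral_eq_lintegral_ofReal hsq (Eventually.of_forall fun x => sq_nonneg _)]
    refine lintegral_congr_ae (ae_restrict_of_ae (hfu.mono fun ξ hξ => ?_))
    simp only [← hξ]
    rw [Real.enorm_eq_ofReal_abs, ← ENNReal.ofReal_pow (abs_nonneg _), sq_abs]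
  have htail : ∀ (x : EuclideanSpace ℝ (Fin n)) (y : ℝ), ‖x‖ < 1 → y ∈ Ioo (0 : ℝ) 1 →
      ∫⁻ ξ in (ball 0 2)ᶜ, ENNReal.ofReal (Pker n s cbar (x - ξ) y) * f ξ ≤
        ENNReal.ofReal (A * √N) := by
    intro x y hx hy
    refine (lintegral_compl_ball_Pker_mul_le (D := V * √N) (by linarith) hc.le (by positivity)
      (fun R hR => ?_) hx hy).trans_eq ?_
    · rw [hfball]
      exact lintegral_ball_enorm_le_of_average_le (by linarith) (hloc R (by linarith))
        (hgrowth R hR)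
    · rw [hA, hcκ]
      congr 1
      ring
  have henorm : ∀ (x : EuclideanSpace ℝ (Fin n)) (y : ℝ), 0 ≤ y →
      ∫⁻ ξ, ‖Pker n s cbar (x - ξ) y * u ξ‖ₑ =
        (∫⁻ ξ in ball 0 2, ENNReal.ofReal (Pker n s cbar (x - ξ) y) * f ξ) +
        ∫⁻ ξ in (ball 0 2)ᶜ, ENNReal.ofReal (Pker n s cbar (x - ξ) y) * f ξ := by
    intro x y hy
    rw [lintegral_add_compl _ measurableSet_ball]
    refine lintegral_congr_ae (hfu.mono fun ξ hξ => ?_)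
    simp only [enorm_mul, ← hξ]
    rw [Real.enorm_of_nonneg (Pker_nonneg hc.le _ hy)]
  refine ⟨fun x y hx hy => ⟨?_, ?_⟩, ?_⟩
  · exact ((hmeasy y).comp (measurable_const.sub measurable_id)).aestronglyMeasurable.mul hu
  · rw [HasFiniteIntegral, henorm x y hy.1.le, ENNReal.add_lt_top]
    refine ⟨?_, (htail x y hx hy).trans_lt ENNReal.ofReal_lt_top⟩
    calc ∫⁻ ξ in ball 0 2, ENNReal.ofReal (Pker n s cbar (x - ξ) y) * f ξ
        ≤ ∫⁻ ξ in ball 0 2, ENNReal.ofReal (cbar * y ^ (-((n : ℝ) + 2 * s))) * f ξ := by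
          gcongr with ξ
          exact Pker_le_of_le_norm (by linarith) hc.le hy.1.le hy.2.le hy.1
            (le_add_of_nonneg_left (sq_nonneg _))
      _ = ENNReal.ofReal (cbar * y ^ (-((n : ℝ) + 2 * s))) * ∫⁻ ξ in ball 0 2, ‖u ξ‖ₑ := by
          rw [lintegral_const_mul' _ _ ENNReal.ofReal_ne_top, hfball]
      _ < ⊤ := ENNReal.mul_lt_top ENNReal.ofReal_lt_top (hloc 2 two_pos).2
  let g : EuclideanSpace ℝ (Fin n) × ℝ → ℝ≥0∞ := fun p =>
    ENNReal.ofReal (p.2 ^ (3 - 2 * s)) * (4 *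
      ((∫⁻ ξ in ball 0 2, ENNReal.ofReal (Pker n s cbar (p.1 - ξ) p.2) * f ξ) ^ 2 +
        ENNReal.ofReal (A * √N) ^ 2))
  have hloc_meas : Measurable fun p : EuclideanSpace ℝ (Fin n) × ℝ =>
      ∫⁻ ξ in ball 0 2, ENNReal.ofReal (Pker n s cbar (p.1 - ξ) p.2) * f ξ :=
    Measurable.lintegral_prod_right' (f := fun p : (EuclideanSpace ℝ (Fin n) × ℝ) ×
      EuclideanSpace ℝ (Fin n) => ENNReal.ofReal (Pker n s cbar (p.1.1 - p.2) p.1.2) * f p.2)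
      (hmeas2.ennreal_ofReal.mul (hf.comp measurable_snd))
  have hg : Measurable g := by
    refine Measurable.mul (by fun_prop) (measurable_const.mul ?_)
    exact (hloc_meas.pow_const 2).add measurable_const
  have hptw : ∀ p ∈ ball (0 : EuclideanSpace ℝ (Fin n)) 1 ×ˢ Ico (0 : ℝ) 1,
      ENNReal.ofReal (p.2 ^ (3 - 2 * s) * (∫ ξ, Pker n s cbar (p.1 - ξ) p.2 * u ξ) ^ 2) ≤ g p := by
    rintro ⟨x, y⟩ ⟨hx, hy⟩
    rcases hy.1.eq_or_lt with rfl | hy0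
    · have h0 : ∀ z : EuclideanSpace ℝ (Fin n), Pker n s cbar z 0 = 0 := fun z => by
        simp [Pker, Real.zero_rpow (show 2 * s ≠ 0 by linarith)]
      simp [h0]
    rw [ENNReal.ofReal_mul (Real.rpow_nonneg hy.1 _)]
    refine mul_le_mul_right ?_ _
    have hx1 : ‖x‖ < 1 := by simpa using hx
    calc ENNReal.ofReal ((∫ ξ, Pker n s cbar (x - ξ) y * u ξ) ^ 2)
        = ‖∫ ξ, Pker n s cbar (x - ξ) y * u ξ‖ₑ ^ 2 := by
          rw [Real.enorm_eq_ofReal_abs, ← ENNReal.ofReal_pow (abs_nonneg _), sq_abs]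
      _ ≤ ((∫⁻ ξ in ball 0 2, ENNReal.ofReal (Pker n s cbar (x - ξ) y) * f ξ) +
            ENNReal.ofReal (A * √N)) ^ 2 := by
          gcongr
          refine (enorm_integral_le_lintegral_enorm _).trans ?_
          rw [henorm x y hy.1]
          gcongr
          exact htail x y hx1 ⟨hy0, hy.2⟩
      _ ≤ _ := by
          generalize (∫⁻ ξ in ball 0 2, ENNReal.ofReal (Pker n s cbar (x - ξ) y) * f ξ) = a
          generalize ENNReal.ofReal (A * √N) = t
          calc (a + t) ^ 2 ≤ (2 * max a t) ^ 2 := by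
                rw [two_mul]
                gcongr
                exacts [le_max_left _ _, le_max_right _ _]
            _ = 4 * max a t ^ 2 := by ring
            _ ≤ 4 * (a ^ 2 + t ^ 2) := by
                gcongr
                rcases max_choice a t with h | h <;> rw [h]
                exacts [le_self_add, le_add_self]
  have hslice : ∀ y ∈ Ioo (0 : ℝ) 1, ∫⁻ x in ball 0 1, g (x, y) ≤
      ENNReal.ofReal (y ^ (3 - 2 * s)) * (4 *
        (ENNReal.ofReal (∫ x in ball (0 : EuclideanSpace ℝ (Fin n)) 2, (u x) ^ 2) +
          ENNReal.ofReal (A ^ 2 * N * V))) := by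
    intro y hy
    have hVtop : volume (ball (0 : EuclideanSpace ℝ (Fin n)) 1) = ENNReal.ofReal V :=
      (ofReal_measureReal measure_ball_lt_top.ne).symm
    have hT : ENNReal.ofReal (A * √N) ^ 2 ≤ ENNReal.ofReal (A ^ 2 * N) := by
      rcases le_or_gt 0 (A * √N) with h | h
      · rw [← ENNReal.ofReal_pow h, mul_pow, Real.sq_sqrt hN]
      · simp [ENNReal.ofReal_of_nonpos h.le]
    simp only [g]
    rw [lintegral_const_mul' _ _ ENNReal.ofReal_ne_top,
      lintegral_const_mul' _ _ (by norm_num), lintegral_add_right _ measurable_const,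
      setLIntegral_const, hVtop]
    gcongr
    · rw [← hfsq, ← lintegral_indicator measurableSet_ball (fun ξ => f ξ ^ 2)]
      refine (setLIntegral_le_lintegral _ _).trans ?_
      have h := lintegral_sq_lintegral_sub_mul_le (μ := volume)
        (hmeasy y).ennreal_ofReal (hf.indicator (measurableSet_ball (x := 0) (ε := 2)))
        (hK y hy.1)
      refine (lintegral_congr fun x => ?_).trans_le
        (h.trans_eq (lintegral_congr fun ξ => ?_))
      · rw [← lintegral_indicator measurableSet_ball]
        simp only [indicator_mul_right]
      · by_cases hξ : ξ ∈ ball (0 : EuclideanSpace ℝ (Fin n)) 2 <;> simp [hξ]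
    · rw [ENNReal.ofReal_mul (p := A ^ 2 * N) (by positivity)]
      gcongr
  calc _ ≤ ∫⁻ p in ball (0 : EuclideanSpace ℝ (Fin n)) 1 ×ˢ Ico (0 : ℝ) 1, g p :=
        setLIntegral_mono' (measurableSet_ball.prod measurableSet_Ico) hptw
    _ = ∫⁻ y in Ico (0 : ℝ) 1, ∫⁻ x in ball 0 1, g (x, y) := by
        rw [Measure.volume_eq_prod, ← Measure.prod_restrict, lintegral_prod_symm' _ hg]
    _ ≤ ∫⁻ y in Ico (0 : ℝ) 1, ENNReal.ofReal (y ^ (3 - 2 * s)) * (4 *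
        (ENNReal.ofReal (∫ x in ball (0 : EuclideanSpace ℝ (Fin n)) 2, (u x) ^ 2) +
          ENNReal.ofReal (A ^ 2 * N * V))) := by
        rw [← restrict_Ioo_eq_restrict_Ico]
        exact setLIntegral_mono' measurableSet_Ioo hslice
    _ ≤ _ := by
        have hU : 0 ≤ ∫ x in ball (0 : EuclideanSpace ℝ (Fin n)) 2, (u x) ^ 2 :=
          integral_nonneg fun x => sq_nonneg _
        rw [lintegral_mul_const _ (by fun_prop), setLIntegral_Ico_rpow (by linarith),
          ← ENNReal.ofReal_add hU (by positivity),
          show (4 : ℝ≥0∞) = ENNReal.ofReal 4 by norm_num,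
          ← ENNReal.ofReal_mul (by norm_num), ← ENNReal.ofReal_mul (by
            rw [show 3 - 2 * s + 1 = 4 - 2 * s by ring]; positivity),
          show 3 - 2 * s + 1 = 4 - 2 * s by ring]
        refine ENNReal.ofReal_le_ofReal ?_
        generalize (∫ x in ball (0 : EuclideanSpace ℝ (Fin n)) 2, (u x) ^ 2) = U at hU ⊢
        calc 1 / (4 - 2 * s) * (4 * (U + A ^ 2 * N * V))
            = 4 / (4 - 2 * s) * (U + A ^ 2 * N * V) := by ring
          _ ≤ 4 / (4 - 2 * s) * ((1 + A ^ 2 * V) * (U + N)) := by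
              gcongr
              have : 0 ≤ A ^ 2 * V * U := by positivity
              nlinarith
          _ = _ := by ring
end
end
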